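/- arXiv:1402.3336 — 4 statements merged into one kernel-verified Lean document; each statement's English description precedes it below -/
import Mathlib

section
/- For every n ≥ 1 and every pattern π of length 3, the number of Latin squares of order n all of whose columns avoid π is exactly n!. -/
/-- A Latin square of order `n`: every row map and every column map is a bijection. -/
def IsLatinSquare {n : ℕ} (L : Fin n → Fin n → Fin n) : Prop :=
  (∀ i, Function.Bijective fun j => L i j) ∧ ∀ j, Function.Bijective fun i => L i j

/-- `f` contains the pattern `π`: there are strictly increasing indices whose values
are order isomorphic to `π`. -/
def ContainsPattern {n k : ℕ} (f : Fin n → Fin n) (π : Equiv.Perm (Fin k)) : Prop :=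
  ∃ idx : Fin k → Fin n, StrictMono idx ∧ ∀ a b, f (idx a) < f (idx b) ↔ π a < π b

/-- `f` avoids the pattern `π`. -/
def AvoidsPattern {n k : ℕ} (f : Fin n → Fin n) (π : Equiv.Perm (Fin k)) : Prop :=
  ¬ ContainsPattern f π

/-- A Latin square avoids `π` if all row maps and all column maps avoid `π`. -/
def LatinAvoids {n k : ℕ} (L : Fin n → Fin n → Fin n) (π : Equiv.Perm (Fin k)) : Prop :=
  (∀ i, AvoidsPattern (fun j => L i j) π) ∧ ∀ j, AvoidsPattern (fun i => L i j) π

/-- If `f` is a permutation of `{0, …, n - 1}` that vanishes at `p`, increases after `p`, and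
differs everywhere from the cyclic shifts vanishing at `q < p`, then `f` is the cyclic shift
vanishing at `p`. -/
lemma eq_shift_of_increasing_after {n p : ℕ} (f : ℕ → ℕ) (hp : p < n) (hlt : ∀ i < n, f i < n)
    (hinj : ∀ i < n, ∀ k < n, f i = f k → i = k) (h0 : f p = 0)
    (hmono : ∀ i k, p < i → i < k → k < n → f i < f k)
    (hne : ∀ q < p, ∀ i < n, f i ≠ if q ≤ i then i - q else n + i - q) :
    ∀ i < n, f i = if p ≤ i then i - p else n + i - p := by
  have hmono' : ∀ i k, p ≤ i → i < k → k < n → f i < f k := by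
    intro i k hi hik hk
    rcases hi.eq_or_lt with rfl | hi
    · by_contra hc
      exact absurd (hinj p hp k hk (by omega)) (by omega)
    · exact hmono i k hi hik hk
  have hlow : ∀ d, p + d < n → d ≤ f (p + d) := by
    intro d
    induction d with
    | zero => omega
    | succ d ih =>
      intro hd
      have h1 := ih (by omega)
      have h2 := hmono' (p + d) (p + (d + 1)) (by omega) (by omega) hd
      omega
  have hlast : f (n - 1) ≤ n - 1 - p := by
    by_contra hc
    have h1 := hlt (n - 1) (by omega)
    have h2 := hne (n - 1 - f (n - 1)) (by omega) (n - 1) (by omega)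
    rw [if_pos (by omega)] at h2
    omega
  have hup : ∀ d, p + d < n → f (n - 1 - d) + d ≤ n - 1 - p := by
    intro d
    induction d with
    | zero => intro _; simpa using hlast
    | succ d ih =>
      intro hd
      have h1 := ih (by omega)
      have h2 := hmono' (n - 1 - (d + 1)) (n - 1 - d) (by omega) (by omega) (by omega)
      omega
  have hright : ∀ i < n, p ≤ i → f i = i - p := by
    intro i hi hpi
    have h1 := hlow (i - p) (by omega)
    have h2 := hup (n - 1 - i) (by omega)
    rw [show p + (i - p) = i by omega] at h1
    rw [show n - 1 - (n - 1 - i) = i by omega] at h2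
    omega
  have hleft : ∀ i < p, f i = n + i - p := by
    intro i
    induction i using Nat.strong_induction_on with
    | _ i ih =>
      intro hi
      have hfi := hlt i (by omega)
      have h1 : n - p ≤ f i := by
        by_contra hc
        have h2 := hright (p + f i) (by omega) (by omega)
        have h3 := hinj i (by omega) (p + f i) (by omega) (by omega)
        omega
      have h2 : f i ≤ n + i - p := by
        by_contra hc
        have h3 := hne (n + i - f i) (by omega) i (by omega)
        rw [if_neg (by omega)] at h3
        omega
      by_contra hc
      have h3 := ih (f i + p - n) (by omega) (by omega)
      have h4 := hinj i (by omega) (f i + p - n) (by omega) (by omega)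
      omega
  intro i hi
  split_ifs with h
  · exact hright i hi h
  · exact hleft i (by omega)

/-- If `f` is a permutation of `{0, …, n - 1}` that vanishes at `p`, increases before `p`, and
differs everywhere from the cyclic shifts vanishing at `q > p`, then `f` is the cyclic shift
vanishing at `p`. -/
lemma eq_shift_of_increasing_before {n p : ℕ} (f : ℕ → ℕ) (hp : p < n) (hlt : ∀ i < n, f i < n)
    (hinj : ∀ i < n, ∀ k < n, f i = f k → i = k) (h0 : f p = 0)
    (hmono : ∀ i k, i < k → k < p → f i < f k)
    (hne : ∀ q < n, p < q → ∀ i < n, f i ≠ if q ≤ i then i - q else n + i - q) :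
    ∀ i < n, f i = if p ≤ i then i - p else n + i - p := by
  have hlow : ∀ i < p, n - p + i ≤ f i := by
    intro i
    induction i with
    | zero =>
      intro hi
      by_contra hc
      have h1 : f 0 ≠ 0 := fun h => absurd (hinj 0 (by omega) p hp (by omega)) (by omega)
      have h2 := hne (n - f 0) (by omega) (by omega) 0 (by omega)
      rw [if_neg (by omega)] at h2
      omega
    | succ i ih =>
      intro hi
      have h1 := ih (by omega)
      have h2 := hmono i (i + 1) (by omega) hi
      omega
  have hup : ∀ d < p, f (p - 1 - d) + d < n := by
    intro d
    induction d with
    | zero => intro _; simpa using hlt (p - 1) (by omega)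
    | succ d ih =>
      intro hd
      have h1 := ih (by omega)
      have h2 := hmono (p - 1 - (d + 1)) (p - 1 - d) (by omega) (by omega)
      omega
  have hleft : ∀ i < p, f i = n + i - p := by
    intro i hi
    have h1 := hlow i hi
    have h2 := hup (p - 1 - i) (by omega)
    rw [show p - 1 - (p - 1 - i) = i by omega] at h2
    omega
  have hright : ∀ d i, i + d + 1 = n → p ≤ i → f i = i - p := by
    intro d
    induction d using Nat.strong_induction_on with
    | _ d ih =>
      intro i hd hi
      have hfi := hlt i (by omega)
      have h1 : f i < n - p := by
        by_contra hc
        have h2 := hleft (f i + p - n) (by omega)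
        have h3 := hinj i (by omega) (f i + p - n) (by omega) (by omega)
        omega
      have h2 : i - p ≤ f i := by
        by_contra hc
        have h3 := hne (i - f i) (by omega) (by omega) i (by omega)
        rw [if_pos (by omega)] at h3
        omega
      by_contra hc
      have h3 := ih (n - 1 - (p + f i)) (by omega) (p + f i) (by omega) (by omega)
      have h4 := hinj i (by omega) (p + f i) (by omega) (by omega)
      omega
  intro i hi
  split_ifs with h
  · exact hright (n - 1 - i) i (by omega) h
  · exact hleft i (by omega)

lemma containsPattern_three_of_lt {n : ℕ} {f : Fin n → Fin n} {π : Equiv.Perm (Fin 3)}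
    {x y z : Fin n} (hxy : x < y) (hyz : y < z)
    (h : ∀ a b, f (![x, y, z] a) < f (![x, y, z] b) ↔ π a < π b) : ContainsPattern f π := by
  refine ⟨![x, y, z], ?_, h⟩
  rw [Fin.strictMono_iff_lt_succ]
  intro i
  fin_cases i
  · exact hxy
  · exact hyz

/-- The value at `i` of the cyclic shift of `{0, …, n - 1}` vanishing at `p`. -/
lemma Fin.val_sub_eq_ite {n : ℕ} (i p : Fin n) :
    ((i - p : Fin n) : ℕ) = if (p : ℕ) ≤ i then (i : ℕ) - p else n + i - p := by
  split_ifs with h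
  · exact Fin.sub_val_of_le h
  · rw [Fin.val_sub, Nat.mod_eq_of_lt (by omega)]
    omega

/-- A column of a Latin square that is distinct from a column `i ↦ i - q` differs from it
everywhere. -/
lemma IsLatinSquare.ne_sub {n : ℕ} [NeZero n] {L : Fin n → Fin n → Fin n} (hL : IsLatinSquare L)
    {p q j : Fin n} (hpq : q ≠ p) (hj : L p j = 0)
    (hq : ∀ k, L q k = 0 → ∀ i, L i k = i - q) (i : Fin n) : L i j ≠ i - q := by
  obtain ⟨k, hk⟩ := (hL.1 q).2 0
  intro h
  obtain rfl : j = k := (hL.1 i).1 (h.trans (hq k hk i).symm)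
  exact hpq ((hL.2 j).1 (hk.trans hj.symm))

lemma IsLatinSquare.eq_sub_of_avoids_swap {n : ℕ} [NeZero n] {L : Fin n → Fin n → Fin n}
    (hL : IsLatinSquare L)
    (hav : ∀ j, AvoidsPattern (fun i => L i j) (Equiv.swap (1 : Fin 3) 2))
    (p : Fin n) : ∀ j, L p j = 0 → ∀ i, L i j = i - p := by
  induction p using WellFoundedLT.induction with
  | _ p ih =>
    intro j hj
    have hinj := (hL.2 j).1
    have key := eq_shift_of_increasing_after (n := n) (p := p)
      (fun x => if h : x < n then (L ⟨x, h⟩ j : ℕ) else 0) p.2 ?_ ?_ ?_ ?_ ?_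
    · intro i
      have := key i i.2
      rw [← Fin.val_sub_eq_ite] at this
      exact Fin.ext (by simpa using this)
    · intro i hi
      simp [hi]
    · intro i hi k hk h
      simp only [hi, hk, dite_true] at h
      exact congrArg Fin.val (hinj (Fin.ext h))
    · simp [hj]
    · intro i k hi hik hk
      have hi' : i < n := hik.trans hk
      simp only [hi', hk, dite_true, Fin.val_fin_lt]
      by_contra hc
      have hc' : L ⟨k, hk⟩ j < L ⟨i, hi'⟩ j := by
        refine lt_of_le_of_ne (not_lt.1 hc) fun h => ?_
        have := congrArg Fin.val (hinj h)
        simp only at this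
        omega
      have hk0 : L p j < L ⟨k, hk⟩ j := by
        rw [hj]
        refine Fin.pos_iff_ne_zero.2 fun h => ?_
        have := congrArg Fin.val (hinj (h.trans hj.symm))
        simp only at this
        omega
      refine hav j (containsPattern_three_of_lt (x := p) (y := ⟨i, hi'⟩) (z := ⟨k, hk⟩) hi hik ?_)
      have h3 := hk0.trans hc'
      intro a b
      fin_cases a <;> fin_cases b <;>
        simp [Equiv.swap_apply_def, hc', hk0, h3, hc'.le, hk0.le, h3.le]
    · intro q hq i hi h
      have hqn : q < n := hq.trans p.2
      simp only [hi, dite_true] at h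
      refine hL.ne_sub (p := p) (q := ⟨q, hqn⟩) (Fin.ne_of_lt hq) hj (ih ⟨q, hqn⟩ hq) ⟨i, hi⟩ ?_
      rw [Fin.ext_iff, Fin.val_sub_eq_ite]
      exact h

lemma IsLatinSquare.eq_sub_of_avoids_rev {n : ℕ} [NeZero n] {L : Fin n → Fin n → Fin n}
    (hL : IsLatinSquare L)
    (hav : ∀ j, AvoidsPattern (fun i => L i j) (Fin.revPerm : Equiv.Perm (Fin 3)))
    (p : Fin n) : ∀ j, L p j = 0 → ∀ i, L i j = i - p := by
  induction p using WellFoundedGT.induction with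
  | _ p ih =>
    intro j hj
    have hinj := (hL.2 j).1
    have key := eq_shift_of_increasing_before (n := n) (p := p)
      (fun x => if h : x < n then (L ⟨x, h⟩ j : ℕ) else 0) p.2 ?_ ?_ ?_ ?_ ?_
    · intro i
      have := key i i.2
      rw [← Fin.val_sub_eq_ite] at this
      exact Fin.ext (by simpa using this)
    · intro i hi
      simp [hi]
    · intro i hi k hk h
      simp only [hi, hk, dite_true] at h
      exact congrArg Fin.val (hinj (Fin.ext h))
    · simp [hj]
    · intro i k hik hkp
      have hk : k < n := hkp.trans p.2
      have hi : i < n := hik.trans hk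
      simp only [hi, hk, dite_true, Fin.val_fin_lt]
      by_contra hc
      have hc' : L ⟨k, hk⟩ j < L ⟨i, hi⟩ j := by
        refine lt_of_le_of_ne (not_lt.1 hc) fun h => ?_
        have := congrArg Fin.val (hinj h)
        simp only at this
        omega
      have hk0 : L p j < L ⟨k, hk⟩ j := by
        rw [hj]
        refine Fin.pos_iff_ne_zero.2 fun h => ?_
        have := congrArg Fin.val (hinj (h.trans hj.symm))
        simp only at this
        omega
      refine hav j (containsPattern_three_of_lt (x := ⟨i, hi⟩) (y := ⟨k, hk⟩) (z := p) hik hkp ?_)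
      have h3 := hk0.trans hc'
      intro a b
      fin_cases a <;> fin_cases b <;>
        simp [Fin.rev, hc', hk0, h3, hc'.le, hk0.le, h3.le]
    · intro q hqn hq i hi h
      simp only [hi, dite_true] at h
      refine hL.ne_sub (p := p) (q := ⟨q, hqn⟩) (Fin.ne_of_gt hq) hj (ih ⟨q, hqn⟩ hq) ⟨i, hi⟩ ?_
      rw [Fin.ext_iff, Fin.val_sub_eq_ite]
      exact h

lemma avoidsPattern_sub_swap {n : ℕ} (p : Fin n) :
    AvoidsPattern (fun i => i - p) (Equiv.swap (1 : Fin 3) 2) := by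
  rintro ⟨idx, hidx, h⟩
  have h01 : idx 0 < idx 1 := hidx (by decide)
  have h12 : idx 1 < idx 2 := hidx (by decide)
  have h1 := (h 0 2).2 (by decide)
  have h2 := (h 2 1).2 (by decide)
  simp only [Fin.lt_def, Fin.val_sub_eq_ite] at h01 h12 h1 h2
  split_ifs at h1 h2 <;> omega

lemma avoidsPattern_sub_rev {n : ℕ} (p : Fin n) :
    AvoidsPattern (fun i => i - p) (Fin.revPerm : Equiv.Perm (Fin 3)) := by
  rintro ⟨idx, hidx, h⟩
  have h01 : idx 0 < idx 1 := hidx (by decide)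
  have h12 : idx 1 < idx 2 := hidx (by decide)
  have h1 := (h 1 0).2 (by decide)
  have h2 := (h 2 1).2 (by decide)
  simp only [Fin.lt_def, Fin.val_sub_eq_ite] at h01 h12 h1 h2
  split_ifs at h1 h2 <;> omega

/-- If avoiding `π` forces every column of a Latin square to be a cyclic shift, and all cyclic
shifts avoid `π`, then there are `n!` Latin squares whose columns avoid `π`. -/
lemma card_latin_of_forall_eq_sub {n k : ℕ} [NeZero n] {π : Equiv.Perm (Fin k)}
    (hshift : ∀ p : Fin n, AvoidsPattern (fun i => i - p) π)
    (hsub : ∀ L : Fin n → Fin n → Fin n, IsLatinSquare L →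
      (∀ j, AvoidsPattern (fun i => L i j) π) → ∀ p j, L p j = 0 → ∀ i, L i j = i - p) :
    Nat.card {L : Fin n → Fin n → Fin n //
      IsLatinSquare L ∧ ∀ j, AvoidsPattern (fun i => L i j) π} = Nat.factorial n := by
  have hlatin : ∀ σ : Equiv.Perm (Fin n), IsLatinSquare fun i j => i - σ j := fun σ =>
    ⟨fun i => (Equiv.subLeft i).bijective.comp σ.bijective,
      fun j => (Equiv.subRight (σ j)).bijective⟩
  let F : Equiv.Perm (Fin n) → {L : Fin n → Fin n → Fin n //
      IsLatinSquare L ∧ ∀ j, AvoidsPattern (fun i => L i j) π} :=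
    fun σ => ⟨fun i j => i - σ j, hlatin σ, fun j => hshift (σ j)⟩
  have hF : Function.Bijective F := by
    constructor
    · intro σ τ h
      ext1 j
      have := congrFun (congrFun (congrArg Subtype.val h) 0) j
      exact sub_right_injective this
    · rintro ⟨L, hL, hav⟩
      have h0 : ∀ i j, L i j = i - -L 0 j := by
        intro i j
        obtain ⟨p, hp⟩ := (hL.2 j).2 0
        have h := hsub L hL hav p j hp
        rw [h i, h 0]
        simp
      refine ⟨(Equiv.ofBijective _ (hL.1 0)).trans (Equiv.neg _), Subtype.ext ?_⟩
      funext i j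
      exact (h0 i j).symm
  rw [← Nat.card_congr (Equiv.ofBijective F hF), Nat.card_perm, Nat.card_fin]

lemma ContainsPattern.comp_rev {n k : ℕ} {f : Fin n → Fin n} {π : Equiv.Perm (Fin k)}
    (h : ContainsPattern f π) : ContainsPattern (fun i => f i.rev) (π * Fin.revPerm) := by
  obtain ⟨idx, hidx, h⟩ := h
  exact ⟨fun a => (idx a.rev).rev,
    fun a b hab => Fin.rev_lt_rev.2 (hidx (Fin.rev_lt_rev.2 hab)), fun a b => by simp [h]⟩

lemma ContainsPattern.rev_comp {n k : ℕ} {f : Fin n → Fin n} {π : Equiv.Perm (Fin k)}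
    (h : ContainsPattern f π) : ContainsPattern (fun i => (f i).rev) (Fin.revPerm * π) := by
  obtain ⟨idx, hidx, h⟩ := h
  exact ⟨idx, hidx, fun a b => by simp [h]⟩

lemma avoidsPattern_comp_rev_iff {n k : ℕ} {f : Fin n → Fin n} {π : Equiv.Perm (Fin k)} :
    AvoidsPattern (fun i => f i.rev) (π * Fin.revPerm) ↔ AvoidsPattern f π := by
  refine not_congr ⟨fun h => ?_, ContainsPattern.comp_rev⟩
  have hπ : π * Fin.revPerm * Fin.revPerm = π := by ext; simp
  simpa [hπ] using h.comp_rev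

lemma avoidsPattern_rev_comp_iff {n k : ℕ} {f : Fin n → Fin n} {π : Equiv.Perm (Fin k)} :
    AvoidsPattern (fun i => (f i).rev) (Fin.revPerm * π) ↔ AvoidsPattern f π := by
  refine not_congr ⟨fun h => ?_, ContainsPattern.rev_comp⟩
  have hπ : Fin.revPerm * (Fin.revPerm * π) = π := by ext; simp
  simpa [hπ] using h.rev_comp

lemma IsLatinSquare.comp_rev {n : ℕ} {L : Fin n → Fin n → Fin n} (hL : IsLatinSquare L) :
    IsLatinSquare fun i j => L i.rev j :=
  ⟨fun i => hL.1 i.rev, fun j => (hL.2 j).comp Fin.rev_bijective⟩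

lemma IsLatinSquare.rev_comp {n : ℕ} {L : Fin n → Fin n → Fin n} (hL : IsLatinSquare L) :
    IsLatinSquare fun i j => (L i j).rev :=
  ⟨fun i => Fin.rev_bijective.comp (hL.1 i), fun j => Fin.rev_bijective.comp (hL.2 j)⟩

lemma card_latin_mul_revPerm (n : ℕ) {k : ℕ} (π : Equiv.Perm (Fin k)) :
    Nat.card {L : Fin n → Fin n → Fin n //
      IsLatinSquare L ∧ ∀ j, AvoidsPattern (fun i => L i j) (π * Fin.revPerm)} =
    Nat.card {L : Fin n → Fin n → Fin n //
      IsLatinSquare L ∧ ∀ j, AvoidsPattern (fun i => L i j) π} := by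
  let e : (Fin n → Fin n → Fin n) ≃ (Fin n → Fin n → Fin n) :=
    ⟨fun L i j => L i.rev j, fun L i j => L i.rev j, fun L => by simp, fun L => by simp⟩
  refine (Nat.card_congr (e.subtypeEquiv fun L => and_congr ⟨fun h => h.comp_rev, fun h => ?_⟩
    (forall_congr' fun j => (avoidsPattern_comp_rev_iff (f := fun i => L i j)).symm))).symm
  simpa [e] using h.comp_rev

lemma card_latin_revPerm_mul (n : ℕ) {k : ℕ} (π : Equiv.Perm (Fin k)) :
    Nat.card {L : Fin n → Fin n → Fin n //
      IsLatinSquare L ∧ ∀ j, AvoidsPattern (fun i => L i j) (Fin.revPerm * π)} =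
    Nat.card {L : Fin n → Fin n → Fin n //
      IsLatinSquare L ∧ ∀ j, AvoidsPattern (fun i => L i j) π} := by
  let e : (Fin n → Fin n → Fin n) ≃ (Fin n → Fin n → Fin n) :=
    ⟨fun L i j => (L i j).rev, fun L i j => (L i j).rev, fun L => by simp, fun L => by simp⟩
  refine (Nat.card_congr (e.subtypeEquiv fun L => and_congr ⟨fun h => h.rev_comp, fun h => ?_⟩
    (forall_congr' fun j => (avoidsPattern_rev_comp_iff (f := fun i => L i j)).symm))).symm
  simpa [e] using h.rev_comp

lemma perm_fin_three_cases (π : Equiv.Perm (Fin 3)) :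
    π = Equiv.swap 1 2 ∨ π = Equiv.swap 1 2 * Fin.revPerm ∨ π = Fin.revPerm * Equiv.swap 1 2 ∨
      π = Fin.revPerm * (Equiv.swap 1 2 * Fin.revPerm) ∨ π = Fin.revPerm ∨
      π = Fin.revPerm * Fin.revPerm := by
  revert π
  decide

/-- For every n ≥ 1 and pattern π of length 3, the number of Latin squares of order n
all of whose columns avoid π is n!. -/
theorem latin_column_avoiding_length_three_card (n : ℕ) (hn : 1 ≤ n) (π : Equiv.Perm (Fin 3)) :
    Nat.card {L : Fin n → Fin n → Fin n //
      IsLatinSquare L ∧ ∀ j, AvoidsPattern (fun i => L i j) π} = Nat.factorial n := by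
  have : NeZero n := ⟨by omega⟩
  have hswap := card_latin_of_forall_eq_sub (n := n) avoidsPattern_sub_swap
    fun _ hL hav => hL.eq_sub_of_avoids_swap hav
  have hrev := card_latin_of_forall_eq_sub (n := n) avoidsPattern_sub_rev
    fun _ hL hav => hL.eq_sub_of_avoids_rev hav
  rcases perm_fin_three_cases π with rfl | rfl | rfl | rfl | rfl | rfl
  · exact hswap
  · rw [card_latin_mul_revPerm, hswap]
  · rw [card_latin_revPerm_mul, hswap]
  · rw [card_latin_revPerm_mul, card_latin_mul_revPerm, hswap]
  · exact hrev
  · rw [card_latin_revPerm_mul, hrev]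
end

section
/- For any Latin square L of order n, the following are equivalent: some row or column of L contains the pattern 321; some row or column of L contains the pattern 132; some row or column of L contains the pattern 213. In other words, a Latin square contains either all of the patterns {132, 213, 321} or none of them. -/
/-- The pattern 123 (identity permutation of `Fin 3`). -/
def pat123 : Equiv.Perm (Fin 3) := Equiv.refl _
/-- The pattern 231 in one-line notation (0-indexed: 0↦1, 1↦2, 2↦0). -/
def pat231 : Equiv.Perm (Fin 3) := ⟨![1,2,0], ![2,0,1], by decide, by decide⟩
/-- The pattern 312 in one-line notation (0-indexed: 0↦2, 1↦0, 2↦1). -/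
def pat312 : Equiv.Perm (Fin 3) := ⟨![2,0,1], ![1,2,0], by decide, by decide⟩
/-- The pattern 321 in one-line notation (0-indexed: 0↦2, 1↦1, 2↦0). -/
def pat321 : Equiv.Perm (Fin 3) := ⟨![2,1,0], ![2,1,0], by decide, by decide⟩
/-- The pattern 132 in one-line notation (0-indexed: 0↦0, 1↦2, 2↦1). -/
def pat132 : Equiv.Perm (Fin 3) := ⟨![0,2,1], ![0,2,1], by decide, by decide⟩
/-- The pattern 213 in one-line notation (0-indexed: 0↦1, 1↦0, 2↦2). -/
def pat213 : Equiv.Perm (Fin 3) := ⟨![1,0,2], ![1,0,2], by decide, by decide⟩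


/-- Some row map or some column map of `L` contains the pattern `π`. -/
def LatinContains {n k : ℕ} (L : Fin n → Fin n → Fin n) (π : Equiv.Perm (Fin k)) : Prop :=
  (∃ i, ContainsPattern (fun j => L i j) π) ∨ ∃ j, ContainsPattern (fun i => L i j) π

theorem containsPattern_pat132_iff {n : ℕ} (f : Fin n → Fin n) :
    ContainsPattern f pat132 ↔ ∃ a b c, a < b ∧ b < c ∧ f a < f c ∧ f c < f b := by
  constructor
  · rintro ⟨idx, hm, h⟩
    exact ⟨idx 0, idx 1, idx 2, hm (by decide), hm (by decide),
      (h 0 2).2 (by decide), (h 2 1).2 (by decide)⟩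
  · rintro ⟨a, b, c, hab, hbc, h1, h2⟩
    refine ⟨![a, b, c], by simp [Fin.strictMono_iff_lt_succ, Fin.forall_fin_succ, hab, hbc], ?_⟩
    simp [Fin.forall_fin_succ, pat132, h1, h2, h1.trans h2, h1.le, h2.le, (h1.trans h2).le]

theorem containsPattern_pat213_iff {n : ℕ} (f : Fin n → Fin n) :
    ContainsPattern f pat213 ↔ ∃ a b c, a < b ∧ b < c ∧ f b < f a ∧ f a < f c := by
  constructor
  · rintro ⟨idx, hm, h⟩
    exact ⟨idx 0, idx 1, idx 2, hm (by decide), hm (by decide),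
      (h 1 0).2 (by decide), (h 0 2).2 (by decide)⟩
  · rintro ⟨a, b, c, hab, hbc, h1, h2⟩
    refine ⟨![a, b, c], by simp [Fin.strictMono_iff_lt_succ, Fin.forall_fin_succ, hab, hbc], ?_⟩
    simp [Fin.forall_fin_succ, pat213, h1, h2, h1.trans h2, h1.le, h2.le, (h1.trans h2).le]

theorem containsPattern_pat321_iff {n : ℕ} (f : Fin n → Fin n) :
    ContainsPattern f pat321 ↔ ∃ a b c, a < b ∧ b < c ∧ f c < f b ∧ f b < f a := by
  constructor
  · rintro ⟨idx, hm, h⟩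
    exact ⟨idx 0, idx 1, idx 2, hm (by decide), hm (by decide),
      (h 2 1).2 (by decide), (h 1 0).2 (by decide)⟩
  · rintro ⟨a, b, c, hab, hbc, h1, h2⟩
    refine ⟨![a, b, c], by simp [Fin.strictMono_iff_lt_succ, Fin.forall_fin_succ, hab, hbc], ?_⟩
    simp [Fin.forall_fin_succ, pat321, h1, h2, h1.trans h2, h1.le, h2.le, (h1.trans h2).le]

/-- The sum `k + j` reduced modulo `n`, for `k, j < n`. -/
def cyclicAdd (n k j : ℕ) : ℕ := if k + j < n then k + j else k + j - n

/-- `f` is the cyclic shift of the identity that starts with the value `k`. -/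
def IsCyclicShift {n : ℕ} (f : Fin n → Fin n) (k : ℕ) : Prop :=
  ∀ j, (f j : ℕ) = cyclicAdd n k j

namespace IsCyclicShift

variable {n k : ℕ} {f : Fin n → Fin n}

theorem avoids_pat132 (hf : IsCyclicShift f k) : AvoidsPattern f pat132 := by
  rw [AvoidsPattern, containsPattern_pat132_iff]
  rintro ⟨a, b, c, hab, hbc, h1, h2⟩
  have := hf a; have := hf b; have := hf c
  simp only [cyclicAdd, Fin.lt_def] at *
  grind

theorem avoids_pat213 (hf : IsCyclicShift f k) : AvoidsPattern f pat213 := by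
  rw [AvoidsPattern, containsPattern_pat213_iff]
  rintro ⟨a, b, c, hab, hbc, h1, h2⟩
  have := hf a; have := hf b; have := hf c
  simp only [cyclicAdd, Fin.lt_def] at *
  grind

theorem avoids_pat321 (hf : IsCyclicShift f k) : AvoidsPattern f pat321 := by
  rw [AvoidsPattern, containsPattern_pat321_iff]
  rintro ⟨a, b, c, hab, hbc, h1, h2⟩
  have := hf a; have := hf b; have := hf c
  simp only [cyclicAdd, Fin.lt_def] at *
  grind

end IsCyclicShift

theorem cyclicAdd_lt {n k j : ℕ} (hk : k < n) (hj : j < n) : cyclicAdd n k j < n := by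
  unfold cyclicAdd
  split_ifs <;> omega

theorem cyclicAdd_left_cancel {n k j j' : ℕ} (hj : j < n) (hj' : j' < n)
    (h : cyclicAdd n k j = cyclicAdd n k j') : j = j' := by
  unfold cyclicAdd at h
  split_ifs at h <;> omega

/-- If a permutation agrees with a cyclic shift before `t` but not at `t`, then the value of the
shift at `t` occurs after `t`. -/
theorem exists_gt_of_agrees_before {n k : ℕ} {f : Fin n → Fin n} (hf : Function.Bijective f)
    (hk : k < n) {t : Fin n} (ih : ∀ j < t, (f j : ℕ) = cyclicAdd n k j)
    (ht : (f t : ℕ) ≠ cyclicAdd n k t) : ∃ p, t < p ∧ (f p : ℕ) = cyclicAdd n k t := by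
  obtain ⟨p, hp⟩ := hf.2 ⟨_, cyclicAdd_lt hk t.isLt⟩
  have hp' : (f p : ℕ) = cyclicAdd n k t := by rw [hp]
  refine ⟨p, ?_, hp'⟩
  rcases lt_trichotomy p t with h | rfl | h
  · exact absurd (Fin.ext (cyclicAdd_left_cancel p.isLt t.isLt ((ih p h).symm.trans hp'))) h.ne
  · exact absurd hp' ht
  · exact h

/-- A permutation avoiding 132 that differs at each position from all the cyclic shifts with a
smaller starting value is itself a cyclic shift. -/
theorem isCyclicShift_of_avoids_pat132 {n : ℕ} [NeZero n] {f : Fin n → Fin n}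
    (hf : Function.Bijective f) (hav : AvoidsPattern f pat132)
    (hne : ∀ j : Fin n, ∀ k < (f 0 : ℕ), (f j : ℕ) ≠ cyclicAdd n k j) :
    IsCyclicShift f (f 0) := by
  have hav' : ∀ a b c, a < b → b < c → f a < f c → f c < f b → False := fun a b c h1 h2 h3 h4 =>
    hav ((containsPattern_pat132_iff f).2 ⟨a, b, c, h1, h2, h3, h4⟩)
  have hpos : ∀ v < n, ∃ p, (f p : ℕ) = v := fun v hv => by
    obtain ⟨p, hp⟩ := hf.2 ⟨v, hv⟩
    exact ⟨p, by rw [hp]⟩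
  have h0 : ((0 : Fin n) : ℕ) = 0 := Fin.val_zero n
  have hk : (f 0 : ℕ) < n := (f 0).isLt
  intro t
  induction t using WellFoundedLT.induction with
  | ind t ih =>
  by_contra hcon
  have ht := t.isLt
  have ht0 : 0 < (t : ℕ) := by
    rcases Nat.eq_zero_or_pos (t : ℕ) with h | h
    · have : t = 0 := Fin.ext (by rw [h, h0])
      subst this
      simp [cyclicAdd] at hcon
    · exact h
  obtain ⟨p, hpt, hp⟩ := exists_gt_of_agrees_before hf hk ih hcon
  have hpn := p.isLt
  rw [Fin.lt_def] at hpt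
  by_cases hkt : (f 0 : ℕ) + t < n
  · have hp' : (f p : ℕ) = f 0 + t := by rw [hp, cyclicAdd, if_pos hkt]
    have hft1 : (f t : ℕ) ≤ f 0 + t := by
      by_contra! h
      exact hav' 0 t p (by rwa [Fin.lt_def, h0]) hpt (by rw [Fin.lt_def]; omega)
        (by rw [Fin.lt_def]; omega)
    have hftt : (f t : ℕ) < t := by
      by_contra! h
      have hne' := hne t (f t - t)
      rw [cyclicAdd, if_pos (by omega)] at hne'
      rw [cyclicAdd, if_pos hkt] at hcon
      omega
    have hftk : (f t : ℕ) < f 0 := by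
      by_contra! h
      have hlt : (f t : ℕ) - f 0 < t := by omega
      have := ih ⟨f t - f 0, by omega⟩ hlt
      rw [cyclicAdd, if_pos (by simp only; omega)] at this
      have := congrArg Fin.val (hf.1 (Fin.ext (this.trans (by simp only; omega) : _ = (f t : ℕ))))
      simp only at this
      omega
    obtain ⟨q, hq⟩ := hpos (n - 1) (by omega)
    have hqn := q.isLt
    have hqt : t < q := by
      rcases lt_trichotomy q t with h | h | h
      · have := ih q h
        rw [Fin.lt_def] at h
        rw [cyclicAdd, if_pos (by omega)] at this
        omega
      · subst h
        omega
      · exact h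
    have hqk : (q : ℕ) + f 0 ≤ n - 1 := by
      by_contra! h
      have := hne q (n - 1 - q) (by omega)
      rw [cyclicAdd, if_pos (by omega)] at this
      omega
    have hmaps : ∀ x ∈ Finset.Ioi q, f x ∈ Finset.Iio (f t) := by
      intro x hx
      rw [Finset.mem_Ioi] at hx
      rw [Finset.mem_Iio]
      by_contra! h
      have h1 : f x ≠ f t := hf.1.ne (hqt.trans hx).ne'
      have h2 : f x ≠ f q := hf.1.ne hx.ne'
      exact hav' t q x hqt hx (lt_of_le_of_ne h h1.symm)
        (lt_of_le_of_ne (by rw [Fin.le_def]; omega) h2)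
    have hcard := Finset.card_le_card_of_injOn f hmaps hf.1.injOn
    rw [Fin.card_Ioi, Fin.card_Iio] at hcard
    omega
  · rw [cyclicAdd, if_neg hkt] at hp
    have := hne p (f 0 + t - p) (by omega)
    rw [cyclicAdd, if_neg (by omega)] at this
    omega

/-- A permutation avoiding 321 that differs at each position from all the cyclic shifts with a
larger starting value is itself a cyclic shift. -/
theorem isCyclicShift_of_avoids_pat321 {n : ℕ} [NeZero n] {f : Fin n → Fin n}
    (hf : Function.Bijective f) (hav : AvoidsPattern f pat321)
    (hne : ∀ j : Fin n, ∀ k, (f 0 : ℕ) < k → k < n → (f j : ℕ) ≠ cyclicAdd n k j) :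
    IsCyclicShift f (f 0) := by
  have hav' : ∀ a b c, a < b → b < c → f c < f b → f b < f a → False := fun a b c h1 h2 h3 h4 =>
    hav ((containsPattern_pat321_iff f).2 ⟨a, b, c, h1, h2, h3, h4⟩)
  have hpos : ∀ v < n, ∃ p, (f p : ℕ) = v := fun v hv => by
    obtain ⟨p, hp⟩ := hf.2 ⟨v, hv⟩
    exact ⟨p, by rw [hp]⟩
  have h0 : ((0 : Fin n) : ℕ) = 0 := Fin.val_zero n
  have hk : (f 0 : ℕ) < n := (f 0).isLt
  intro t
  induction t using WellFoundedLT.induction with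
  | ind t ih =>
  by_contra hcon
  have ht := t.isLt
  have hft := (f t).isLt
  have ht0 : 0 < (t : ℕ) := by
    rcases Nat.eq_zero_or_pos (t : ℕ) with h | h
    · have : t = 0 := Fin.ext (by rw [h, h0])
      subst this
      simp [cyclicAdd] at hcon
    · exact h
  obtain ⟨p, hpt, hp⟩ := exists_gt_of_agrees_before hf hk ih hcon
  have hpn := p.isLt
  rw [Fin.lt_def] at hpt
  have hftk : (f t : ℕ) < f 0 + t → (f t : ℕ) < f 0 := by
    intro h
    by_contra! h'
    have hlt : (f t : ℕ) - f 0 < t := by omega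
    have := ih ⟨f t - f 0, by omega⟩ hlt
    rw [cyclicAdd, if_pos (by simp only; omega)] at this
    have := congrArg Fin.val (hf.1 (Fin.ext (this.trans (by simp only; omega) : _ = (f t : ℕ))))
    simp only at this
    omega
  by_cases hkt : (f 0 : ℕ) + t < n
  · rw [cyclicAdd, if_pos hkt] at hcon hp
    have hle : (f t : ℕ) ≤ f 0 + t := by
      by_contra! h
      have := hne t (f t - t) (by omega) (by omega)
      rw [cyclicAdd, if_pos (by omega)] at this
      omega
    have hftk := hftk (by omega)
    have htft : 0 < (f t : ℕ) := by
      by_contra! h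
      have := hne t (n - t) (by omega) (by omega)
      rw [cyclicAdd, if_neg (by omega)] at this
      omega
    obtain ⟨q, hq⟩ := hpos 0 (by omega)
    have hqt : t < q := by
      rcases lt_trichotomy q t with h | h | h
      · have := ih q h
        rw [Fin.lt_def] at h
        rw [cyclicAdd, if_pos (by omega)] at this
        omega
      · subst h
        omega
      · exact h
    exact hav' 0 t q (by rwa [Fin.lt_def, h0]) hqt (by rw [Fin.lt_def]; omega)
      (by rw [Fin.lt_def]; omega)
  · rw [cyclicAdd, if_neg hkt] at hcon hp
    have hftk := hftk (by omega)
    have hle : (f 0 + t - n : ℕ) ≤ f t := by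
      by_contra! h
      have hlt : (f t : ℕ) + n - f 0 < t := by omega
      have := ih ⟨f t + n - f 0, by omega⟩ hlt
      rw [cyclicAdd, if_neg (by simp only; omega)] at this
      have := congrArg Fin.val (hf.1 (Fin.ext (this.trans (by simp only; omega) : _ = (f t : ℕ))))
      simp only at this
      omega
    exact hav' 0 t p (by rwa [Fin.lt_def, h0]) hpt (by rw [Fin.lt_def]; omega)
      (by rw [Fin.lt_def]; omega)

namespace IsLatinSquare

variable {n : ℕ} {L : Fin n → Fin n → Fin n}

theorem transpose (hL : IsLatinSquare L) : IsLatinSquare fun i j => L j i := ⟨hL.2, hL.1⟩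

theorem rev (hL : IsLatinSquare L) : IsLatinSquare fun i j => (L i j.rev).rev :=
  ⟨fun i => Fin.rev_bijective.comp ((hL.1 i).comp Fin.rev_bijective),
    fun j => Fin.rev_bijective.comp (hL.2 j.rev)⟩

theorem exists_row_shift_of_avoids_pat132 (hL : IsLatinSquare L)
    (h : ∀ i, AvoidsPattern (fun j => L i j) pat132) (i : Fin n) :
    ∃ k < n, IsCyclicShift (fun j => L i j) k := by
  have : NeZero n := ⟨by have := i.isLt; omega⟩
  refine ⟨L i 0, (L i 0).isLt, ?_⟩
  induction hk : L i 0 using WellFoundedLT.induction generalizing i with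
  | ind k ih =>
  subst hk
  refine isCyclicShift_of_avoids_pat132 (hL.1 i) (h i) fun j k hk heq => ?_
  obtain ⟨i', hi'⟩ := (hL.2 0).2 ⟨k, hk.trans (L i 0).isLt⟩
  have hlt : L i' 0 < L i 0 := by simpa [Fin.lt_def, hi'] using hk
  have := ih _ hlt i' rfl j
  have hii : i' = i := (hL.2 j).1 (Fin.ext (by simp_all))
  exact hlt.ne (by rw [hii])

theorem exists_row_shift_of_avoids_pat321 (hL : IsLatinSquare L)
    (h : ∀ i, AvoidsPattern (fun j => L i j) pat321) (i : Fin n) :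
    ∃ k < n, IsCyclicShift (fun j => L i j) k := by
  have : NeZero n := ⟨by have := i.isLt; omega⟩
  refine ⟨L i 0, (L i 0).isLt, ?_⟩
  induction hk : L i 0 using WellFoundedGT.induction generalizing i with
  | ind k ih =>
  subst hk
  refine isCyclicShift_of_avoids_pat321 (hL.1 i) (h i) fun j k hk hkn heq => ?_
  obtain ⟨i', hi'⟩ := (hL.2 0).2 ⟨k, hkn⟩
  have hlt : L i 0 < L i' 0 := by simpa [Fin.lt_def, hi'] using hk
  have := ih _ hlt i' rfl j
  have hii : i' = i := (hL.2 j).1 (Fin.ext (by simp_all))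
  exact hlt.ne' (by rw [hii])

theorem exists_row_shift_of_avoids_pat213 (hL : IsLatinSquare L)
    (h : ∀ i, AvoidsPattern (fun j => L i j) pat213) (i : Fin n) :
    ∃ k < n, IsCyclicShift (fun j => L i j) k := by
  have hrev : ∀ i, AvoidsPattern (fun j => (L i j.rev).rev) pat132 := by
    intro i hc
    obtain ⟨a, b, c, hab, hbc, h1, h2⟩ := (containsPattern_pat132_iff _).1 hc
    exact h i ((containsPattern_pat213_iff _).2 ⟨c.rev, b.rev, a.rev, Fin.rev_lt_rev.2 hbc,
      Fin.rev_lt_rev.2 hab, Fin.rev_lt_rev.1 h2, Fin.rev_lt_rev.1 h1⟩)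
  obtain ⟨k, hkn, hk⟩ := hL.rev.exists_row_shift_of_avoids_pat132 hrev i
  refine ⟨if k = 0 then 0 else n - k, by split_ifs <;> omega, fun j => ?_⟩
  have hkj := hk j.rev
  have := j.isLt
  have := (L i j).isLt
  simp only [Fin.rev_rev, Fin.val_rev, cyclicAdd] at hkj ⊢
  split_ifs at * <;> omega

end IsLatinSquare

theorem latinAvoids_of_shifts {n : ℕ} {L : Fin n → Fin n → Fin n} {π : Equiv.Perm (Fin 3)}
    (hπ : ∀ (f : Fin n → Fin n) k, IsCyclicShift f k → AvoidsPattern f π)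
    (hrow : ∀ i, ∃ k < n, IsCyclicShift (fun j => L i j) k)
    (hcol : ∀ j, ∃ k < n, IsCyclicShift (fun i => L i j) k) : LatinAvoids L π :=
  ⟨fun i => (hrow i).elim fun k hk => hπ _ k hk.2, fun j => (hcol j).elim fun k hk => hπ _ k hk.2⟩

theorem not_latinContains_iff {n k : ℕ} {L : Fin n → Fin n → Fin n} {π : Equiv.Perm (Fin k)} :
    ¬ LatinContains L π ↔ LatinAvoids L π := by
  simp [LatinContains, LatinAvoids, AvoidsPattern]

/-- A Latin square contains either all of the patterns 321, 132, 213 (in some row or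
column), or none of them. -/
theorem latin_contains_321_132_213_iff (n : ℕ) (L : Fin n → Fin n → Fin n)
    (hL : IsLatinSquare L) :
    (LatinContains L pat321 ↔ LatinContains L pat132) ∧
    (LatinContains L pat132 ↔ LatinContains L pat213) := by
  have h321 : LatinAvoids L pat321 → LatinAvoids L pat132 := fun h =>
    latinAvoids_of_shifts (fun _ _ => IsCyclicShift.avoids_pat132)
      (hL.exists_row_shift_of_avoids_pat321 h.1)
      (hL.transpose.exists_row_shift_of_avoids_pat321 h.2)
  have h132 : LatinAvoids L pat132 → LatinAvoids L pat213 ∧ LatinAvoids L pat321 := fun h =>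
    have hrow := hL.exists_row_shift_of_avoids_pat132 h.1
    have hcol := hL.transpose.exists_row_shift_of_avoids_pat132 h.2
    ⟨latinAvoids_of_shifts (fun _ _ => IsCyclicShift.avoids_pat213) hrow hcol,
      latinAvoids_of_shifts (fun _ _ => IsCyclicShift.avoids_pat321) hrow hcol⟩
  have h213 : LatinAvoids L pat213 → LatinAvoids L pat132 := fun h =>
    latinAvoids_of_shifts (fun _ _ => IsCyclicShift.avoids_pat132)
      (hL.exists_row_shift_of_avoids_pat213 h.1)
      (hL.transpose.exists_row_shift_of_avoids_pat213 h.2)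
  simp only [← not_latinContains_iff] at h321 h132 h213
  grind
end

section
/- For every n ≥ 1 and any two permutations π and ρ of Fin n, the number of Latin squares of order n avoiding π equals the number of Latin squares of order n avoiding ρ; that is, for patterns of length equal to the order of the square, L_n(π) depends only on n. -/
theorem StrictMono.eq_id_fin {n : ℕ} {f : Fin n → Fin n} (hf : StrictMono f) : f = id :=
  (hf.range_inj strictMono_id).1 <| by
    rw [(Finite.injective_iff_surjective.1 hf.injective).range_eq, Set.range_id]

theorem containsPattern_iff_eq {n : ℕ} {f : Fin n → Fin n} {π : Equiv.Perm (Fin n)} :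
    ContainsPattern f π ↔ f = π := by
  constructor
  · rintro ⟨idx, hidx, h⟩
    obtain rfl := hidx.eq_id_fin
    have hmono : StrictMono (f ∘ π.symm) := fun a b hab =>
      (h (π.symm a) (π.symm b)).2 (by simpa using hab)
    funext x
    simpa using congrFun hmono.eq_id_fin (π x)
  · rintro rfl
    exact ⟨id, strictMono_id, fun _ _ => Iff.rfl⟩

theorem avoidsPattern_comp_iff {n : ℕ} (σ π : Equiv.Perm (Fin n)) (f : Fin n → Fin n) :
    AvoidsPattern (fun x => σ (f x)) (σ * π) ↔ AvoidsPattern f π := by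
  simp [AvoidsPattern, containsPattern_iff_eq, funext_iff]

theorem isLatinSquare_comp_iff {n : ℕ} (σ : Equiv.Perm (Fin n)) (L : Fin n → Fin n → Fin n) :
    IsLatinSquare (fun i j => σ (L i j)) ↔ IsLatinSquare L :=
  and_congr (forall_congr' fun i => σ.comp_bijective fun j => L i j)
    (forall_congr' fun j => σ.comp_bijective fun i => L i j)

theorem latinAvoids_comp_iff {n : ℕ} (σ π : Equiv.Perm (Fin n)) (L : Fin n → Fin n → Fin n) :
    LatinAvoids (fun i j => σ (L i j)) (σ * π) ↔ LatinAvoids L π :=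
  and_congr (forall_congr' fun i => avoidsPattern_comp_iff σ π fun j => L i j)
    (forall_congr' fun j => avoidsPattern_comp_iff σ π fun i => L i j)

/-- For patterns of length equal to the order of the square, L_n(π) depends only on n. -/
theorem latin_avoiding_full_length_card_eq (n : ℕ) (hn : 1 ≤ n)
    (π ρ : Equiv.Perm (Fin n)) :
    Nat.card {L : Fin n → Fin n → Fin n // IsLatinSquare L ∧ LatinAvoids L π} =
      Nat.card {L : Fin n → Fin n → Fin n // IsLatinSquare L ∧ LatinAvoids L ρ} := by
  obtain ⟨σ, rfl⟩ : ∃ σ, ρ = σ * π := ⟨ρ * π⁻¹, by simp⟩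
  exact Nat.card_congr <|
    (Equiv.arrowCongr (Equiv.refl _) (Equiv.arrowCongr (Equiv.refl _) σ)).subtypeEquiv fun L =>
      and_congr (isLatinSquare_comp_iff σ L).symm (latinAvoids_comp_iff σ π L).symm
end

section
/- For every n > 1, every Latin square of order n has a row or a column containing a monotone subsequence of length ⌊3/2 + √(n − 7/4)⌋. -/
/-- `f` has a monotone (strictly increasing or strictly decreasing) subsequence of length `m`. -/
def HasMonotoneSubseq {n : ℕ} (f : Fin n → Fin n) (m : ℕ) : Prop :=
  ∃ idx : Fin m → Fin n, StrictMono idx ∧ (StrictMono (f ∘ idx) ∨ StrictAnti (f ∘ idx))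

/-- Erdős–Szekeres: an injective function on a finite set with more than `r * q` elements is
strictly increasing on more than `r` of them or strictly decreasing on more than `q` of them. -/
theorem exists_strictMonoOn_or_strictAntiOn {α β : Type*} [LinearOrder α] [LinearOrder β]
    (f : α → β) (hf : Function.Injective f) (q r : ℕ) (s : Finset α) (hs : r * q < s.card) :
    (∃ t ⊆ s, r < t.card ∧ StrictMonoOn f t) ∨ ∃ t ⊆ s, q < t.card ∧ StrictAntiOn f t := by
  induction r generalizing s with
  | zero =>
    obtain ⟨x, hx⟩ := Finset.card_pos.1 (by omega : 0 < s.card)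
    exact Or.inl ⟨{x}, by simpa using hx, by simp, by simp⟩
  | succ r ih =>
    classical
    set A := s.filter fun x => ∀ y ∈ s, y < x → f x < f y with hA
    have hAs : A ⊆ s := Finset.filter_subset _ _
    by_cases hq : q < A.card
    · refine Or.inr ⟨A, hAs, hq, fun x hx y hy hxy => ?_⟩
      exact (Finset.mem_filter.1 hy).2 x (hAs hx) hxy
    have hcard : r * q < (s \ A).card := by
      rw [Finset.card_sdiff_of_subset hAs]
      rw [add_mul] at hs
      omega
    rcases ih (s \ A) hcard with ⟨t, hts, htr, ht⟩ | ⟨t, hts, htq, ht⟩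
    · have hne : t.Nonempty := Finset.card_pos.1 (by omega)
      have hmin := hts (t.min'_mem hne)
      obtain ⟨hs', hA'⟩ := Finset.mem_sdiff.1 hmin
      obtain ⟨y, hys, hyt, hfy⟩ : ∃ y ∈ s, y < t.min' hne ∧ f y ≤ f (t.min' hne) := by
        simpa [hA, hs'] using hA'
      have hlt : ∀ z ∈ t, y < z := fun z hz => hyt.trans_le (t.min'_le z hz)
      have hflt : ∀ z ∈ t, f y < f z := fun z hz =>
        (hfy.lt_of_ne (hf.ne hyt.ne)).trans_le
          (ht.monotoneOn (t.min'_mem hne) hz (t.min'_le z hz))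
      refine Or.inl ⟨insert y t, ?_, ?_, ?_⟩
      · exact Finset.insert_subset hys (hts.trans Finset.sdiff_subset)
      · rw [Finset.card_insert_of_notMem fun h => (hlt y h).false]
        omega
      · intro a ha b hb hab
        rcases Finset.mem_insert.1 ha with rfl | hat <;> rcases Finset.mem_insert.1 hb with rfl | hbt
        · exact absurd hab (lt_irrefl _)
        · exact hflt b hbt
        · exact absurd hab (hlt a hat).not_gt
        · exact ht hat hbt hab
    · exact Or.inr ⟨t, hts.trans Finset.sdiff_subset, htq, ht⟩

theorem hasMonotoneSubseq_of_finset {n m : ℕ} {f : Fin n → Fin n} {t : Finset (Fin n)}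
    (hm : m ≤ t.card) (ht : StrictMonoOn f t ∨ StrictAntiOn f t) : HasMonotoneSubseq f m := by
  obtain ⟨u, hut, hu⟩ := Finset.exists_subset_card_eq hm
  have hmem : ∀ a, u.orderEmbOfFin hu a ∈ t := fun a => hut (u.orderEmbOfFin_mem hu a)
  have hmono := (u.orderEmbOfFin hu).strictMono
  exact ⟨u.orderEmbOfFin hu, hmono, ht.imp (fun h a b hab => h (hmem a) (hmem b) (hmono hab))
    fun h a b hab => h (hmem a) (hmem b) (hmono hab)⟩

/-- If the first value of an injective `f` is its maximum and `f` has at least `k * (k - 1) + 2`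
values, then `f` has a monotone subsequence of length `k + 1`. -/
theorem hasMonotoneSubseq_of_first_max {n k : ℕ} {f : Fin n → Fin n} (hf : Function.Injective f)
    (z : Fin n) (hz : ∀ x, z ≤ x) (hmax : ∀ x, f x ≤ f z) (hk : k * (k - 1) + 2 ≤ n) :
    HasMonotoneSubseq f (k + 1) := by
  have hcard : k * (k - 1) < (Finset.univ.erase z).card := by
    rw [Finset.card_erase_of_mem (Finset.mem_univ z), Finset.card_fin]
    omega
  rcases exists_strictMonoOn_or_strictAntiOn f hf (k - 1) k _ hcard with
    ⟨t, -, htk, ht⟩ | ⟨t, hts, htk, ht⟩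
  · exact hasMonotoneSubseq_of_finset htk (Or.inl ht)
  · have hzt : ∀ x ∈ t, x ≠ z := fun x hx => Finset.ne_of_mem_erase (hts hx)
    refine hasMonotoneSubseq_of_finset (t := insert z t) ?_ (Or.inr ?_)
    · rw [Finset.card_insert_of_notMem fun h => hzt z h rfl]
      omega
    · intro a ha b hb hab
      rcases Finset.mem_insert.1 hb with rfl | hbt
      · exact absurd hab (hz a).not_gt
      · rcases Finset.mem_insert.1 ha with rfl | hat
        · exact (hmax b).lt_of_ne (hf.ne (hzt b hbt))
        · exact ht hat hbt hab

theorem exists_floor_sqrt_eq_succ {n : ℕ} (hn : 1 < n) :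
    ∃ k : ℕ, ⌊(3 / 2 : ℝ) + Real.sqrt ((n : ℝ) - 7 / 4)⌋₊ = k + 1 ∧ k * (k - 1) + 2 ≤ n := by
  have hn2 : (2 : ℝ) ≤ n := by exact_mod_cast hn
  set x := Real.sqrt ((n : ℝ) - 7 / 4) with hx
  have hx0 : 1 / 2 ≤ x := Real.le_sqrt_of_sq_le (by linarith)
  have hsq : x ^ 2 = n - 7 / 4 := Real.sq_sqrt (by linarith)
  have hfloor : 2 ≤ ⌊(3 / 2 : ℝ) + x⌋₊ := Nat.le_floor (by push_cast; linarith)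
  have hle : (⌊(3 / 2 : ℝ) + x⌋₊ : ℝ) ≤ 3 / 2 + x := Nat.floor_le (by linarith)
  obtain ⟨l, hl⟩ := Nat.exists_eq_add_of_le' hfloor
  refine ⟨l + 1, hl, ?_⟩
  rw [hl] at hle
  push_cast at hle
  have hl0 : (0 : ℝ) ≤ l := Nat.cast_nonneg l
  have : ((l : ℝ) + 1) * l + 2 ≤ n := by nlinarith
  rw [Nat.add_sub_cancel]
  exact_mod_cast this

/-- For n > 1, every Latin square of order n has a row or a column with a monotone
subsequence of length ⌊3/2 + √(n − 7/4)⌋. -/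
theorem latin_monotone_subseq_sqrt_bound (n : ℕ) (hn : 1 < n)
    (L : Fin n → Fin n → Fin n) (hL : IsLatinSquare L) :
    (∃ i, HasMonotoneSubseq (fun j => L i j) ⌊(3 / 2 : ℝ) + Real.sqrt ((n : ℝ) - 7 / 4)⌋₊) ∨
      ∃ j, HasMonotoneSubseq (fun i => L i j) ⌊(3 / 2 : ℝ) + Real.sqrt ((n : ℝ) - 7 / 4)⌋₊ := by
  obtain ⟨k, hk, hkn⟩ := exists_floor_sqrt_eq_succ hn
  rw [hk]
  obtain ⟨i, hi⟩ := (hL.2 ⟨0, by omega⟩).2 ⟨n - 1, by omega⟩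
  refine Or.inl ⟨i, hasMonotoneSubseq_of_first_max (hL.1 i).1 ⟨0, by omega⟩
    (fun x => Nat.zero_le _) (fun x => ?_) hkn⟩
  dsimp only at hi ⊢
  rw [hi, Fin.le_def]
  exact Nat.le_sub_one_of_lt (L i x).2
end
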